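/- Let Z* ∈ ℝ^{n×N} satisfy Z*(Z*)^T = Id, let W* ∈ ℝ^{n×n} be orthogonal, and set P = (W*)^T Z*. Let Z^1 = Z* + Δ where Δ ∈ ℝ^{n×N} satisfies S(Δ_{(k,·)}) ⊆ S(Z*_{(k,·)}) for every k, and ‖Δ‖_F ≤ ε for some ε < √2 − 1. Let W^1 be an orthogonal n×n matrix minimizing ‖W P − Z^1‖_F over all orthogonal n×n matrices W. Then ‖W^1 − W*‖_F ≤ q‖Δ‖_F + C(ε)·ε², where q := max_{1≤k≤n} ‖D_k Z* D̃_k‖_2. -/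

import Mathlib

open Matrix MeasureTheory ProbabilityTheory Filter
open scoped Kronecker

noncomputable section

/-- Frobenius norm of a real matrix. -/
def frobNorm {m n : Type*} [Fintype m] [Fintype n] (M : Matrix m n ℝ) : ℝ :=
  Real.sqrt (∑ i, ∑ j, (M i j) ^ 2)

/-- Spectral norm (largest singular value) of a real matrix. -/
def specNorm {m n : Type*} [Fintype m] [Fintype n] [DecidableEq n] (M : Matrix m n ℝ) : ℝ :=
  ‖LinearMap.toContinuousLinearMap (Matrix.toEuclideanLin M)‖

/-- Smallest singular value of a real matrix (as the infimum of `‖Mᵀ x‖` over unit vectors). -/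
def sigmaMin {m n : Type*} [Fintype m] [Fintype n] [DecidableEq m] (M : Matrix m n ℝ) : ℝ :=
  sInf {c : ℝ | ∃ x : EuclideanSpace ℝ m, ‖x‖ = 1 ∧ c = ‖Matrix.toEuclideanLin Mᵀ x‖}

/-- Condition number: ratio of largest to smallest singular value. -/
def condNum {m n : Type*} [Fintype m] [Fintype n] [DecidableEq m] [DecidableEq n]
    (M : Matrix m n ℝ) : ℝ :=
  specNorm M / sigmaMin M

/-- `D_k`: diagonal matrix with ones on the diagonal except a zero at `(k,k)`. -/
def Dk {n : Type*} [Fintype n] [DecidableEq n] (k : n) : Matrix n n ℝ :=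
  Matrix.diagonal (fun i => if i = k then 0 else 1)

/-- `D̃_k`: diagonal matrix with ones at columns in the support of the `k`-th row of `Z`. -/
def Dtil {n N : Type*} [Fintype n] [Fintype N] [DecidableEq N]
    (Z : Matrix n N ℝ) (k : n) : Matrix N N ℝ :=
  Matrix.diagonal (fun j => if Z k j ≠ 0 then 1 else 0)

/-- `max_{1 ≤ k ≤ n} ‖D_k Z D̃_k‖₂`. -/
def qmax {n N : Type*} [Fintype n] [Fintype N] [DecidableEq n] [DecidableEq N]
    (Z : Matrix n N ℝ) : ℝ :=
  ⨆ k : n, specNorm (Dk k * Z * Dtil Z k)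

/-- `z = H_s(v)`: hard thresholding of `v` to its `s` largest-magnitude entries. -/
def IsHardThresh {n : ℕ} (s : ℕ) (v z : Fin n → ℝ) : Prop :=
  ∃ T : Finset (Fin n), T.card = s ∧ (∀ i ∈ T, ∀ j ∉ T, |v j| ≤ |v i|) ∧
    (∀ i ∈ T, z i = v i) ∧ (∀ i ∉ T, z i = 0)

/-- Euclidean norm of a vector. -/
def l2norm {n : ℕ} (v : Fin n → ℝ) : ℝ := Real.sqrt (∑ i, (v i) ^ 2)

/-- `β(v)`: smallest magnitude among the nonzero entries of `v`. -/
def betaMin {n : ℕ} (v : Fin n → ℝ) : ℝ :=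
  sInf {c : ℝ | ∃ i, v i ≠ 0 ∧ c = |v i|}

/-- The constant `C(ε₀)` from the convergence-radius analysis. -/
def Cconst (e : ℝ) : ℝ :=
  2 + 9 * Real.sqrt 2 / (8 * (1 - 2 * e - e ^ 2) ^ ((3 : ℝ) / 2)) + Real.sqrt 2 / (1 - e)

end

lemma frobNorm_nonneg {m n : Type*} [Fintype m] [Fintype n] (M : Matrix m n ℝ) :
    0 ≤ frobNorm M :=
  Real.sqrt_nonneg _

lemma frobNorm_sq_eq_sum {m n : Type*} [Fintype m] [Fintype n] (M : Matrix m n ℝ) :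
    frobNorm M ^ 2 = ∑ i, ∑ j, M i j ^ 2 :=
  Real.sq_sqrt (Finset.sum_nonneg fun _ _ => Finset.sum_nonneg fun _ _ => sq_nonneg _)

lemma frobNorm_sq_eq_trace {m n : Type*} [Fintype m] [Fintype n] (M : Matrix m n ℝ) :
    frobNorm M ^ 2 = trace (M * Mᵀ) := by
  simp [frobNorm_sq_eq_sum, trace, Matrix.mul_apply, ← sq]

open scoped Matrix.Norms.Frobenius in
lemma frobNorm_eq_norm {m n : Type*} [Fintype m] [Fintype n] (M : Matrix m n ℝ) :
    frobNorm M = ‖M‖ := by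
  simp [frobNorm, frobenius_norm_def, Real.sqrt_eq_rpow]

open scoped Matrix.Norms.Frobenius in
lemma frobNorm_add_le {m n : Type*} [Fintype m] [Fintype n] (A B : Matrix m n ℝ) :
    frobNorm (A + B) ≤ frobNorm A + frobNorm B := by
  simpa only [frobNorm_eq_norm] using norm_add_le A B

open scoped Matrix.Norms.Frobenius in
lemma frobNorm_sub_le {m n : Type*} [Fintype m] [Fintype n] (A B : Matrix m n ℝ) :
    frobNorm (A - B) ≤ frobNorm A + frobNorm B := by
  simpa only [frobNorm_eq_norm] using norm_sub_le A B

open scoped Matrix.Norms.Frobenius in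
lemma frobNorm_mul_le {l m n : Type*} [Fintype l] [Fintype m] [Fintype n]
    (A : Matrix l m ℝ) (B : Matrix m n ℝ) :
    frobNorm (A * B) ≤ frobNorm A * frobNorm B := by
  simpa only [frobNorm_eq_norm] using frobenius_norm_mul A B

open scoped Matrix.Norms.Frobenius in
lemma frobNorm_smul {m n : Type*} [Fintype m] [Fintype n] (c : ℝ) (A : Matrix m n ℝ) :
    frobNorm (c • A) = |c| * frobNorm A := by
  simpa only [frobNorm_eq_norm, Real.norm_eq_abs] using norm_smul c A

lemma frobNorm_transpose {m n : Type*} [Fintype m] [Fintype n] (A : Matrix m n ℝ) :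
    frobNorm Aᵀ = frobNorm A := by
  unfold frobNorm
  rw [Finset.sum_comm]
  rfl

lemma frobNorm_mul_of_mul_transpose_eq_one {l m n : Type*} [Fintype l] [Fintype m] [Fintype n]
    [DecidableEq m] (X : Matrix l m ℝ) {Z : Matrix m n ℝ} (hZ : Z * Zᵀ = 1) :
    frobNorm (X * Z) = frobNorm X := by
  rw [← sq_eq_sq₀ (frobNorm_nonneg _) (frobNorm_nonneg _), frobNorm_sq_eq_trace,
    frobNorm_sq_eq_trace, transpose_mul, Matrix.mul_assoc, ← Matrix.mul_assoc Z, hZ,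
    Matrix.one_mul]

lemma frobNorm_mul_transpose_le {l m n : Type*} [Fintype l] [Fintype m] [Fintype n]
    [DecidableEq m] (A : Matrix l n ℝ) {Z : Matrix m n ℝ} (hZ : Z * Zᵀ = 1) :
    frobNorm (A * Zᵀ) ≤ frobNorm A := by
  rw [← sq_le_sq₀ (frobNorm_nonneg _) (frobNorm_nonneg _)]
  have h := sq_nonneg (frobNorm (A - A * Zᵀ * Z))
  have hid : (A - A * Zᵀ * Z) * (A - A * Zᵀ * Z)ᵀ = A * Aᵀ - (A * Zᵀ) * (A * Zᵀ)ᵀ := by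
    have hc : A * Zᵀ * Z * (Zᵀ * (Z * Aᵀ)) = A * Zᵀ * (Z * Aᵀ) := by
      rw [Matrix.mul_assoc (A * Zᵀ), ← Matrix.mul_assoc Z, hZ, Matrix.one_mul]
    simp only [transpose_sub, transpose_mul, transpose_transpose, Matrix.sub_mul, Matrix.mul_sub, hc]
    simp only [Matrix.mul_assoc]
    abel
  rw [frobNorm_sq_eq_trace, hid, trace_sub, ← frobNorm_sq_eq_trace, ← frobNorm_sq_eq_trace] at h
  linarith

/-- If `S` maximizes `G ↦ trace (G * S)` over orthogonal `G` at `G = 1`, then `S` is symmetric. -/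
lemma transpose_eq_of_trace_mul_le {n : Type*} [Fintype n] [DecidableEq n] {S : Matrix n n ℝ}
    (hS : ∀ G : Matrix n n ℝ, Gᵀ * G = 1 → trace (G * S) ≤ trace S) : Sᵀ = S := by
  ext i j
  rw [transpose_apply]
  by_cases hij : i = j
  · rw [hij]
  set K : Matrix n n ℝ := single i j 1 - single j i 1 with hK
  have hKt : Kᵀ = -K := by simp [hK]
  have hK3 : K * (K * K) = -K := by
    simp [hK, Matrix.sub_mul, Matrix.mul_sub, hij, Ne.symm hij]
    abel
  have hb : trace (K * S) = S j i - S i j := by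
    simp [hK, Matrix.sub_mul, trace_single_mul]
  set a := trace (K * K * S)
  have key : ∀ t : ℝ, t * (S j i - S i j) + t ^ 2 * a ≤ 0 := by
    intro t
    have ht : 0 < 1 + t ^ 2 := by positivity
    have hG := hS (1 + (2 * t / (1 + t ^ 2)) • K + (2 * t ^ 2 / (1 + t ^ 2)) • (K * K)) (by
      have hK4 : K * K * (K * K) = -(K * K) := by
        rw [Matrix.mul_assoc, hK3, Matrix.mul_neg]
      have hK3' : K * K * K = -K := by rw [Matrix.mul_assoc, hK3]
      simp only [transpose_add, transpose_smul, transpose_one, transpose_mul, hKt,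
        Matrix.add_mul, Matrix.mul_add, Matrix.smul_mul, Matrix.mul_smul, Matrix.one_mul,
        Matrix.mul_one, Matrix.neg_mul, Matrix.mul_neg, neg_neg, hK3, hK3', hK4]
      match_scalars <;> field_simp <;> ring)
    rw [Matrix.add_mul, Matrix.add_mul, Matrix.one_mul, Matrix.smul_mul, Matrix.smul_mul,
      trace_add, trace_add, trace_smul, trace_smul, hb, smul_eq_mul, smul_eq_mul] at hG
    have h2 : (2 * t / (1 + t ^ 2)) * (S j i - S i j) + (2 * t ^ 2 / (1 + t ^ 2)) * a
        = 2 * (t * (S j i - S i j) + t ^ 2 * a) / (1 + t ^ 2) := by ring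
    have h3 : 2 * (t * (S j i - S i j) + t ^ 2 * a) / (1 + t ^ 2) ≤ 0 := by
      rw [← h2]; linarith
    rw [div_le_iff₀ ht] at h3
    linarith
  set b := S j i - S i j
  have hd : 0 < |a| + 1 := by positivity
  have h := key (b / (|a| + 1))
  have h1 : b / (|a| + 1) * b + (b / (|a| + 1)) ^ 2 * a
      = b ^ 2 * (|a| + 1 + a) / (|a| + 1) ^ 2 := by field_simp
  rw [h1, div_le_iff₀ (by positivity), zero_mul] at h
  have h4 : 0 < |a| + 1 + a := by linarith [neg_abs_le a]
  have h5 : b ^ 2 ≤ 0 := nonpos_of_mul_nonpos_left h h4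
  have h6 : b = 0 := pow_eq_zero_iff two_ne_zero |>.1 (le_antisymm h5 (sq_nonneg b))
  exact sub_eq_zero.1 h6

lemma sum_mulVec_sq_le {m n : Type*} [Fintype m] [Fintype n] [DecidableEq n]
    (M : Matrix m n ℝ) (v : n → ℝ) :
    ∑ i, (M *ᵥ v) i ^ 2 ≤ specNorm M ^ 2 * ∑ j, v j ^ 2 := by
  have h := (LinearMap.toContinuousLinearMap (Matrix.toEuclideanLin M)).le_opNorm (WithLp.toLp 2 v)
  have h2 := pow_le_pow_left₀ (norm_nonneg _) h 2
  rw [mul_pow, EuclideanSpace.norm_sq_eq, EuclideanSpace.norm_sq_eq] at h2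
  simpa [specNorm, Matrix.toLpLin_apply] using h2

lemma specNorm_le_qmax {n N : Type*} [Fintype n] [Fintype N] [DecidableEq n] [DecidableEq N]
    (Z : Matrix n N ℝ) (k : n) : specNorm (Dk k * Z * Dtil Z k) ≤ qmax Z :=
  le_ciSup (f := fun k => specNorm (Dk k * Z * Dtil Z k)) (Set.finite_range _).bddAbove k

lemma qmax_nonneg {n N : Type*} [Fintype n] [Fintype N] [DecidableEq n] [DecidableEq N]
    (Z : Matrix n N ℝ) : 0 ≤ qmax Z :=
  Real.iSup_nonneg fun _ => norm_nonneg _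

/-- The off-diagonal part of `Δ * Zᵀ` is controlled by `qmax Z` when every row of `Δ` is supported
in the corresponding row of `Z`. -/
lemma sum_offDiag_sq_le {n N : Type*} [Fintype n] [Fintype N] [DecidableEq n] [DecidableEq N]
    (Z Δ : Matrix n N ℝ) (hsupp : ∀ k, {j | Δ k j ≠ 0} ⊆ {j | Z k j ≠ 0}) :
    ∑ k, ∑ i, (if i = k then 0 else (Δ * Zᵀ) k i) ^ 2 ≤ (qmax Z * frobNorm Δ) ^ 2 := by
  rw [mul_pow, frobNorm_sq_eq_sum, Finset.mul_sum]
  refine Finset.sum_le_sum fun k _ => ?_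
  have hv : Dtil Z k *ᵥ Δ k = Δ k := by
    ext j
    rw [Dtil, mulVec_diagonal]
    by_cases hz : Z k j = 0
    · have : Δ k j = 0 := by
        by_contra hne
        exact hsupp k hne hz
      simp [this]
    · simp [hz]
  have hrow : ∀ i, ((Dk k * Z * Dtil Z k) *ᵥ Δ k) i = if i = k then 0 else (Δ * Zᵀ) k i := by
    intro i
    rw [← mulVec_mulVec, hv, ← mulVec_mulVec, Dk, mulVec_diagonal]
    split_ifs <;> simp [mulVec, dotProduct, Matrix.mul_apply, mul_comm]
  simp only [← hrow]
  refine (sum_mulVec_sq_le _ _).trans ?_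
  gcongr
  · exact norm_nonneg _
  · exact specNorm_le_qmax Z k

lemma frobNorm_half_sub_transpose_le {n N : Type*} [Fintype n] [Fintype N] [DecidableEq n]
    [DecidableEq N] (Z Δ : Matrix n N ℝ) (hsupp : ∀ k, {j | Δ k j ≠ 0} ⊆ {j | Z k j ≠ 0}) :
    frobNorm ((1 / 2 : ℝ) • (Δ * Zᵀ - (Δ * Zᵀ)ᵀ)) ≤ qmax Z * frobNorm Δ := by
  set O : Matrix n n ℝ := of fun k i => if i = k then 0 else (Δ * Zᵀ) k i with hO
  have hOn : frobNorm O ≤ qmax Z * frobNorm Δ := by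
    rw [← sq_le_sq₀ (frobNorm_nonneg _) (mul_nonneg (qmax_nonneg _) (frobNorm_nonneg _)),
      frobNorm_sq_eq_sum]
    exact sum_offDiag_sq_le Z Δ hsupp
  have hsub : Δ * Zᵀ - (Δ * Zᵀ)ᵀ = O - Oᵀ := by
    ext k i
    by_cases h : i = k
    · simp [hO, h, -transpose_mul]
    · simp [hO, h, Ne.symm h, -transpose_mul]
  have hle := frobNorm_sub_le O Oᵀ
  rw [frobNorm_transpose] at hle
  rw [hsub, frobNorm_smul, abs_of_pos (by norm_num)]
  linarith

lemma four_le_Cconst {e : ℝ} (h0 : 0 ≤ e) (h1 : e < Real.sqrt 2 - 1) : 4 ≤ Cconst e := by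
  have hs : Real.sqrt 2 ^ 2 = 2 := Real.sq_sqrt (by norm_num)
  have hs1 : 1.4 ≤ Real.sqrt 2 := Real.le_sqrt_of_sq_le (by norm_num)
  have hs2 : Real.sqrt 2 ≤ 1.5 := Real.sqrt_le_iff.2 (by norm_num)
  have hpos : 0 < 1 - 2 * e - e ^ 2 := by nlinarith
  have hr0 : 0 < (1 - 2 * e - e ^ 2) ^ ((3 : ℝ) / 2) := Real.rpow_pos_of_pos hpos _
  have hr1 : (1 - 2 * e - e ^ 2) ^ ((3 : ℝ) / 2) ≤ 1 :=
    Real.rpow_le_one hpos.le (by nlinarith) (by norm_num)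
  have ha : 9 * Real.sqrt 2 / 8 ≤
      9 * Real.sqrt 2 / (8 * (1 - 2 * e - e ^ 2) ^ ((3 : ℝ) / 2)) := by
    gcongr
    linarith
  have hb : Real.sqrt 2 ≤ Real.sqrt 2 / (1 - e) := by
    rw [le_div_iff₀ (by linarith)]
    nlinarith
  unfold Cconst
  linarith

/-- The error `U - 1` of an optimal orthogonal alignment `U` of `Z` to `Z + Δ` equals the
skew-symmetric part of `Δ * Zᵀ` up to a quadratic remainder. -/
lemma frobNorm_sub_one_le {n N : Type*} [Fintype n] [Fintype N] [DecidableEq n]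
    {Z Δ : Matrix n N ℝ} (hZ : Z * Zᵀ = 1) {U : Matrix n n ℝ} (hU : Uᵀ * U = 1)
    (hmin : ∀ Y : Matrix n n ℝ, Yᵀ * Y = 1 →
      frobNorm (U * Z - (Z + Δ)) ≤ frobNorm (Y * Z - (Z + Δ))) :
    frobNorm (U - 1) ≤
      frobNorm ((1 / 2 : ℝ) • (Δ * Zᵀ - (Δ * Zᵀ)ᵀ)) + 4 * frobNorm Δ ^ 2 := by
  have hexp : ∀ Y : Matrix n n ℝ, Yᵀ * Y = 1 → frobNorm (Y * Z - (Z + Δ)) ^ 2 =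
      trace (1 : Matrix n n ℝ) - 2 * trace (Y * (Z * (Z + Δ)ᵀ)) + frobNorm (Z + Δ) ^ 2 := by
    intro Y hY
    have hY' : Y * Yᵀ = 1 := mul_eq_one_comm.1 hY
    have h1 : Y * Z * (Zᵀ * Yᵀ) = 1 := by
      rw [Matrix.mul_assoc, ← Matrix.mul_assoc Z, hZ, Matrix.one_mul, hY']
    have h2 : trace ((Z + Δ) * (Zᵀ * Yᵀ)) = trace (Y * (Z * (Z + Δ)ᵀ)) := by
      rw [← trace_transpose]
      simp only [transpose_mul, transpose_transpose, Matrix.mul_assoc]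
    rw [frobNorm_sq_eq_trace, frobNorm_sq_eq_trace, transpose_sub, Matrix.sub_mul, Matrix.mul_sub,
      Matrix.mul_sub, transpose_mul, h1, trace_sub, trace_sub, trace_sub, h2,
      Matrix.mul_assoc Y Z]
    ring
  have hsymm : (U * (Z * (Z + Δ)ᵀ))ᵀ = U * (Z * (Z + Δ)ᵀ) := by
    refine transpose_eq_of_trace_mul_le fun G hG => ?_
    have hGU : (G * U)ᵀ * (G * U) = 1 := by
      rw [transpose_mul, Matrix.mul_assoc, ← Matrix.mul_assoc Gᵀ, hG, Matrix.one_mul, hU]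
    have h := pow_le_pow_left₀ (frobNorm_nonneg _) (hmin _ hGU) 2
    rw [hexp _ hU, hexp _ hGU, Matrix.mul_assoc G U] at h
    linarith
  have hX : frobNorm (U - 1) ≤ 2 * frobNorm Δ := by
    have h1 := hmin 1 (by simp)
    have h2 : (1 : Matrix n n ℝ) * Z - (Z + Δ) = (-1 : ℝ) • Δ := by
      rw [Matrix.one_mul, neg_one_smul]; abel
    have h3 : (U - 1) * Z = (U * Z - (Z + Δ)) + Δ := by
      rw [Matrix.sub_mul, Matrix.one_mul]; abel
    rw [h2, frobNorm_smul, abs_neg, abs_one, one_mul] at h1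
    rw [← frobNorm_mul_of_mul_transpose_eq_one _ hZ, h3]
    linarith [frobNorm_add_le (U * Z - (Z + Δ)) Δ]
  have hE := frobNorm_mul_transpose_le Δ hZ
  have hU' : U * Uᵀ = 1 := mul_eq_one_comm.1 hU
  have hF : Z * (Z + Δ)ᵀ = 1 + (Δ * Zᵀ)ᵀ := by
    rw [transpose_add, Matrix.mul_add, hZ, transpose_mul, transpose_transpose]
  rw [hF] at hsymm
  set E := Δ * Zᵀ
  set X := U - 1 with hXdef
  have hUX : U = 1 + X := by rw [hXdef]; abel
  rw [hUX] at hsymm hU'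
  have hid : X = (1 / 2 : ℝ) • (E - Eᵀ) +
      (1 / 2 : ℝ) • ((E * Xᵀ - X * Eᵀ) - X * Xᵀ) := by
    simp only [transpose_add, transpose_mul, transpose_one, transpose_transpose, Matrix.add_mul,
      Matrix.mul_add, Matrix.one_mul, Matrix.mul_one] at hsymm hU'
    have h1 : (2 : ℝ) • X = (E - Eᵀ) + ((E * Xᵀ - X * Eᵀ) - X * Xᵀ) := by
      rw [two_smul, ← sub_eq_zero]
      have e1 := sub_eq_zero.2 hsymm
      have e2 := sub_eq_zero.2 hU'
      have e3 := congrArg₂ (· - ·) e2 e1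
      simp only [sub_zero] at e3
      rw [← e3]
      abel
    rw [← smul_add, ← h1, smul_smul]
    norm_num
  have hr : frobNorm ((1 / 2 : ℝ) • ((E * Xᵀ - X * Eᵀ) - X * Xᵀ)) ≤ 4 * frobNorm Δ ^ 2 := by
    rw [frobNorm_smul, abs_of_pos (by norm_num)]
    have h1 := frobNorm_sub_le (E * Xᵀ - X * Eᵀ) (X * Xᵀ)
    have h2 := frobNorm_sub_le (E * Xᵀ) (X * Eᵀ)
    have h3 := frobNorm_mul_le E Xᵀ
    have h4 := frobNorm_mul_le X Eᵀ
    have h5 := frobNorm_mul_le X Xᵀ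
    rw [frobNorm_transpose] at h3 h4 h5
    have h6 : frobNorm E * frobNorm X ≤ frobNorm Δ * (2 * frobNorm Δ) :=
      mul_le_mul hE hX (frobNorm_nonneg _) (frobNorm_nonneg _)
    have h7 : frobNorm X * frobNorm X ≤ 2 * frobNorm Δ * (2 * frobNorm Δ) :=
      mul_self_le_mul_self (frobNorm_nonneg _) hX
    linarith
  calc frobNorm X = _ := congrArg frobNorm hid
    _ ≤ _ := frobNorm_add_le _ _
    _ ≤ _ := by gcongr

/-- the operator-update error bound for one step, given a coefficient
perturbation supported within the true supports. -/
theorem stmt8 (n N : ℕ)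
    (Wstar : Matrix (Fin n) (Fin n) ℝ) (Zstar P : Matrix (Fin n) (Fin N) ℝ)
    (hrows : Zstar * Zstarᵀ = 1)
    (hWorth : Wstarᵀ * Wstar = 1)
    (hP : P = Wstarᵀ * Zstar)
    (Δ Z1 : Matrix (Fin n) (Fin N) ℝ)
    (hZ1 : Z1 = Zstar + Δ)
    (hsupp : ∀ k : Fin n, {j : Fin N | Δ k j ≠ 0} ⊆ {j : Fin N | Zstar k j ≠ 0})
    (ε : ℝ) (hΔ : frobNorm Δ ≤ ε) (hε : ε < Real.sqrt 2 - 1)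
    (W1 : Matrix (Fin n) (Fin n) ℝ)
    (hW1orth : W1ᵀ * W1 = 1)
    (hW1min : ∀ W' : Matrix (Fin n) (Fin n) ℝ, W'ᵀ * W' = 1 →
      frobNorm (W1 * P - Z1) ≤ frobNorm (W' * P - Z1)) :
    frobNorm (W1 - Wstar) ≤ qmax Zstar * frobNorm Δ + Cconst ε * ε ^ 2 := by
  subst hP hZ1
  have hW' : Wstar * Wstarᵀ = 1 := mul_eq_one_comm.1 hWorth
  have hU : (W1 * Wstarᵀ)ᵀ * (W1 * Wstarᵀ) = 1 := by
    rw [transpose_mul, transpose_transpose, Matrix.mul_assoc, ← Matrix.mul_assoc W1ᵀ, hW1orth,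
      Matrix.one_mul, hW']
  have hmain := frobNorm_sub_one_le (Δ := Δ) hrows hU fun Y hY => by
    have h := hW1min (Y * Wstar) (by
      rw [transpose_mul, Matrix.mul_assoc, ← Matrix.mul_assoc Yᵀ, hY, Matrix.one_mul, hWorth])
    rwa [Matrix.mul_assoc Y, ← Matrix.mul_assoc Wstar, hW', Matrix.one_mul,
      ← Matrix.mul_assoc W1] at h
  have hfac : (W1 * Wstarᵀ - 1) * Wstar = W1 - Wstar := by
    rw [Matrix.sub_mul, Matrix.mul_assoc, hWorth, Matrix.mul_one, Matrix.one_mul]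
  have h0 := frobNorm_nonneg Δ
  have hsq : 4 * frobNorm Δ ^ 2 ≤ Cconst ε * ε ^ 2 :=
    mul_le_mul (four_le_Cconst (h0.trans hΔ) hε) (pow_le_pow_left₀ h0 hΔ 2) (sq_nonneg _)
      (by linarith [four_le_Cconst (h0.trans hΔ) hε])
  rw [← hfac, frobNorm_mul_of_mul_transpose_eq_one _ hW']
  linarith [frobNorm_half_sub_transpose_le Zstar Δ hsupp]
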